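/- (Proposition 2.8: Dynkin-automorphism invariance.) Let N ≥ 3. For i ∈ ℤ/Nℤ define the operators (all indices mod N, so x̂_{i+N} = x̂_i): A_i := e_q(−x̂_{i+1}) ∘ ⋯ ∘ e_q(−x̂_{i+N−2}) ∘ e_q(−x̂_{i+N−1}) ∘ e_q(−x̂_{i+N−2})^{−1} ∘ ⋯ ∘ e_q(−x̂_{i+1})^{−1} ∘ e_q(−x̂_i) ∘ e_q(−x̂_{i+1}) ∘ ⋯ ∘ e_q(−x̂_{i+N−2}); B_i := e_q(−x̂_{i+1}) ∘ ⋯ ∘ e_q(−x̂_{i+N−1}) ∘ e_q(−x̂_{i+N−2}∘⋯∘x̂_{i+1}∘x̂_i) ∘ ⋯ ∘ e_q(−x̂_{i+1}∘x̂_i) ∘ e_q(−x̂_i); and B̃_i := e_q(−x̂_i) ∘ e_q(−x̂_i∘x̂_{i−1}) ∘ ⋯ ∘ e_q(−x̂_i∘x̂_{i−1}∘⋯∘x̂_{i+2}) ∘ e_q(−x̂_{i+1}) ∘ e_q(−x̂_{i+2}) ∘ ⋯ ∘ e_q(−x̂_{i+N−1}). Then A_i = B_i = B̃_i for every i ∈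 ℤ/Nℤ, and moreover these operators do not depend on i (so the common operator is invariant under the Dynkin automorphism group of A_{N−1}^{(1)}). -/

import Mathlib

/-!
Proposition 2.8 (Dynkin-automorphism invariance).  Setting as in the paper:
`V = MvPowerSeries (ZMod N) ℂ`, `p i : x^ν ↦ q^{ν_i} x^ν`,
`x̂_i = M_{α_i x_i} ∘ p_i ∘ p_{i−1}⁻¹`, and for degree-raising `T`,
`e_q(−T) = ∑ (−1)ⁿTⁿ/(q;q)_n` and `E_q(T) = e_q(−T)⁻¹ = ∑ q^{n(n−1)/2}Tⁿ/(q;q)_n`,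
defined by their (finite) coefficientwise sums.
-/

noncomputable section
open scoped Classical

variable {N : ℕ}

def qPoch (q : ℂ) (n : ℕ) : ℂ := ∏ k ∈ Finset.range n, (1 - q ^ (k + 1))

def degOf (ν : ZMod N →₀ ℕ) : ℕ := ν.sum fun _ k => k

def pmap (q : ℂ) (i : ZMod N) (f : MvPowerSeries (ZMod N) ℂ) : MvPowerSeries (ZMod N) ℂ :=
  fun ν => q ^ (ν i) * f ν

def pinv (q : ℂ) (i : ZMod N) (f : MvPowerSeries (ZMod N) ℂ) : MvPowerSeries (ZMod N) ℂ :=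
  fun ν => q ^ (-(ν i : ℤ)) * f ν

/-- `x̂_i := M_{α_i x_i} ∘ p_i ∘ p_{i−1}⁻¹`. -/
def xhat (q : ℂ) (α : ZMod N → ℂ) (i : ZMod N) (f : MvPowerSeries (ZMod N) ℂ) :
    MvPowerSeries (ZMod N) ℂ :=
  α i • (MvPowerSeries.X i * pmap q i (pinv q (i - 1) f))

def eqExp (q : ℂ) (T : MvPowerSeries (ZMod N) ℂ → MvPowerSeries (ZMod N) ℂ)
    (f : MvPowerSeries (ZMod N) ℂ) : MvPowerSeries (ZMod N) ℂ :=
  fun ν => ∑ n ∈ Finset.range (degOf ν + 1), ((-1 : ℂ) ^ n / qPoch q n) * (T^[n] f) ν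

def EqExp (q : ℂ) (T : MvPowerSeries (ZMod N) ℂ → MvPowerSeries (ZMod N) ℂ)
    (f : MvPowerSeries (ZMod N) ℂ) : MvPowerSeries (ZMod N) ℂ :=
  fun ν => ∑ n ∈ Finset.range (degOf ν + 1), (q ^ (n * (n - 1) / 2) / qPoch q n) * (T^[n] f) ν

def compAsc {α : Type*} (F : ℕ → α → α) : ℕ → α → α
  | 0 => id
  | k + 1 => compAsc F k ∘ F k

def compDesc {α : Type*} (F : ℕ → α → α) : ℕ → α → α
  | 0 => id
  | k + 1 => F k ∘ compDesc F k

/-- `A_i := e(−x̂_{i+1}) ∘ ⋯ ∘ e(−x̂_{i+N−2}) ∘ e(−x̂_{i+N−1})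
            ∘ e(−x̂_{i+N−2})⁻¹ ∘ ⋯ ∘ e(−x̂_{i+1})⁻¹
            ∘ e(−x̂_i) ∘ e(−x̂_{i+1}) ∘ ⋯ ∘ e(−x̂_{i+N−2})`,
with `e(−x̂_j)⁻¹ = E_q(x̂_j)`. -/
def Ablock (q : ℂ) (N : ℕ) [NeZero N] (α : ZMod N → ℂ) (i : ZMod N) :
    MvPowerSeries (ZMod N) ℂ → MvPowerSeries (ZMod N) ℂ :=
  (compAsc (fun j => eqExp q (xhat q α (i + ((j + 1 : ℕ) : ZMod N)))) (N - 2))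
    ∘ eqExp q (xhat q α (i + (((N - 1 : ℕ)) : ZMod N)))
    ∘ (compDesc (fun j => EqExp q (xhat q α (i + ((j + 1 : ℕ) : ZMod N)))) (N - 2))
    ∘ eqExp q (xhat q α i)
    ∘ (compAsc (fun j => eqExp q (xhat q α (i + ((j + 1 : ℕ) : ZMod N)))) (N - 2))

/-- `B_i := e(−x̂_{i+1}) ∘ ⋯ ∘ e(−x̂_{i+N−1})
            ∘ e(−x̂_{i+N−2}⋯x̂_{i+1}x̂_i) ∘ ⋯ ∘ e(−x̂_{i+1}x̂_i) ∘ e(−x̂_i)`. -/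
def Bblock (q : ℂ) (N : ℕ) [NeZero N] (α : ZMod N → ℂ) (i : ZMod N) :
    MvPowerSeries (ZMod N) ℂ → MvPowerSeries (ZMod N) ℂ :=
  (compAsc (fun j => eqExp q (xhat q α (i + ((j + 1 : ℕ) : ZMod N)))) (N - 1))
    ∘ (compAsc (fun j =>
        eqExp q (compDesc (fun m => xhat q α (i + (m : ℕ))) ((N - 2 - j) + 1))) (N - 2))
    ∘ eqExp q (xhat q α i)

/-- `B̃_i := e(−x̂_i) ∘ e(−x̂_i x̂_{i−1}) ∘ ⋯ ∘ e(−x̂_i x̂_{i−1}⋯x̂_{i+2})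
            ∘ e(−x̂_{i+1}) ∘ e(−x̂_{i+2}) ∘ ⋯ ∘ e(−x̂_{i+N−1})`,
where `x̂_i∘x̂_{i−1}∘⋯∘x̂_{i−m}` is `compAsc (fun j => x̂_{i−j}) (m+1)`. -/
def Btblock (q : ℂ) (N : ℕ) [NeZero N] (α : ZMod N → ℂ) (i : ZMod N) :
    MvPowerSeries (ZMod N) ℂ → MvPowerSeries (ZMod N) ℂ :=
  (compAsc (fun m =>
      eqExp q (compAsc (fun j => xhat q α (i - (j : ℕ))) (m + 1))) (N - 1))
    ∘ (compAsc (fun j => eqExp q (xhat q α (i + ((j + 1 : ℕ) : ZMod N)))) (N - 1))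

/-! ### Sums along a separated filtration of an algebra -/

section Filtration

variable {A : Type*} [Ring A] [Algebra ℂ A]

/-- A separated decreasing multiplicative filtration by subspaces. -/
structure IsSepFiltration (J : ℕ → Submodule ℂ A) : Prop where
  one_mem : (1 : A) ∈ J 0
  mul_mem : ∀ {m n a b}, a ∈ J m → b ∈ J n → a * b ∈ J (m + n)
  anti : Antitone J
  eq_zero : ∀ {a}, (∀ n, a ∈ J n) → a = 0

/-- `s` is the sum of the series `∑ t n`, whose `n`-th tail lies in `J n`. -/
def IsSeriesSum (J : ℕ → Submodule ℂ A) (t : ℕ → A) (s : A) : Prop :=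
  ∀ M, s - ∑ n ∈ Finset.range M, t n ∈ J M

/-- `s` is the value at `T` of the power series `F`. -/
def IsEval (J : ℕ → Submodule ℂ A) (F : PowerSeries ℂ) (T s : A) : Prop :=
  IsSeriesSum J (fun n => PowerSeries.coeff n F • T ^ n) s

variable {J : ℕ → Submodule ℂ A}

namespace IsSepFiltration

lemma mem_zero (hJ : IsSepFiltration J) {n : ℕ} {a : A} (h : a ∈ J n) : a ∈ J 0 :=
  hJ.anti (Nat.zero_le n) h

lemma mul_mem_left (hJ : IsSepFiltration J) {n : ℕ} {a b : A} (ha : a ∈ J 0) (hb : b ∈ J n) :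
    a * b ∈ J n := by
  simpa using hJ.mul_mem ha hb

lemma mul_mem_right (hJ : IsSepFiltration J) {n : ℕ} {a b : A} (ha : a ∈ J n) (hb : b ∈ J 0) :
    a * b ∈ J n :=
  hJ.mul_mem ha hb

lemma mul_mem_one (hJ : IsSepFiltration J) {a b : A} (ha : a ∈ J 1) (hb : b ∈ J 1) :
    a * b ∈ J 1 :=
  hJ.mul_mem_right ha (hJ.mem_zero hb)

lemma pow_mem (hJ : IsSepFiltration J) {T : A} (hT : T ∈ J 1) (n : ℕ) : T ^ n ∈ J n := by
  induction n with
  | zero => simpa using hJ.one_mem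
  | succ n ih => rw [pow_succ]; exact hJ.mul_mem ih hT

end IsSepFiltration

namespace IsSeriesSum

variable {t u : ℕ → A} {s r z : A}

lemma mem_zero (h : IsSeriesSum J t s) : s ∈ J 0 := by simpa using h 0

lemma term_mem (hJ : IsSepFiltration J) (h : IsSeriesSum J t s) (n : ℕ) : t n ∈ J n := by
  have h1 := (J n).sub_mem (h n) (hJ.anti (Nat.le_succ n) (h (n + 1)))
  rw [Finset.sum_range_succ] at h1
  convert h1 using 1
  abel

lemma unique (hJ : IsSepFiltration J) (h : IsSeriesSum J t s) (h' : IsSeriesSum J t r) :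
    s = r := by
  refine sub_eq_zero.mp (hJ.eq_zero fun n => ?_)
  simpa using (J n).sub_mem (h n) (h' n)

lemma add (h : IsSeriesSum J t s) (h' : IsSeriesSum J u r) :
    IsSeriesSum J (fun n => t n + u n) (s + r) := fun M => by
  rw [Finset.sum_add_distrib, add_sub_add_comm]
  exact (J M).add_mem (h M) (h' M)

lemma const_mul (hJ : IsSepFiltration J) (hz : z ∈ J 0) (h : IsSeriesSum J t s) :
    IsSeriesSum J (fun n => z * t n) (z * s) := fun M => by
  rw [← Finset.mul_sum, ← mul_sub]
  exact hJ.mul_mem_left hz (h M)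

lemma mul_const (hJ : IsSepFiltration J) (hz : z ∈ J 0) (h : IsSeriesSum J t s) :
    IsSeriesSum J (fun n => t n * z) (s * z) := fun M => by
  rw [← Finset.sum_mul, ← sub_mul]
  exact hJ.mul_mem_right (h M) hz

lemma semiconj (hJ : IsSepFiltration J) (hz : z ∈ J 0) (h : IsSeriesSum J t s)
    (h' : IsSeriesSum J u r) (htu : ∀ n, z * t n = u n * z) : z * s = r * z := by
  have h1 := h.const_mul hJ hz
  simp only [htu] at h1
  exact h1.unique hJ (h'.mul_const hJ hz)

lemma mul (hJ : IsSepFiltration J) (h : IsSeriesSum J t s) (h' : IsSeriesSum J u r) :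
    IsSeriesSum J (fun n => ∑ p ∈ Finset.HasAntidiagonal.antidiagonal n, t p.1 * u p.2) (s * r) := fun M => by
  have key : s * r - ∑ n ∈ Finset.range M, ∑ p ∈ Finset.HasAntidiagonal.antidiagonal n, t p.1 * u p.2
      = (s - ∑ k ∈ Finset.range M, t k) * r
        + ∑ k ∈ Finset.range M, t k * (r - ∑ l ∈ Finset.range (M - k), u l) := by
    simp only [Finset.Nat.sum_antidiagonal_eq_sum_range_succ (fun a b => t a * u b)]
    rw [Finset.sum_range_diag_flip M (fun a b => t a * u b)]
    simp only [mul_sub, sub_mul, Finset.sum_sub_distrib, Finset.mul_sum, Finset.sum_mul]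
    abel
  rw [key]
  refine (J M).add_mem (hJ.mul_mem_right (h M) h'.mem_zero) ((J M).sum_mem fun k hk => ?_)
  have h1 := hJ.mul_mem (h.term_mem hJ k) (h' (M - k))
  rwa [Nat.add_sub_cancel' (Finset.mem_range.mp hk).le] at h1

end IsSeriesSum

namespace IsEval

variable {F G : PowerSeries ℂ} {T s r : A}

lemma add (h : IsEval J F T s) (h' : IsEval J G T r) : IsEval J (F + G) T (s + r) := by
  simpa only [IsEval, map_add, add_smul] using IsSeriesSum.add h h'

lemma mul (hJ : IsSepFiltration J) (h : IsEval J F T s) (h' : IsEval J G T r) :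
    IsEval J (F * G) T (s * r) := by
  unfold IsEval
  convert IsSeriesSum.mul hJ h h' using 2 with n
  rw [PowerSeries.coeff_mul, Finset.sum_smul]
  refine Finset.sum_congr rfl fun p hp => ?_
  rw [smul_mul_smul_comm, ← pow_add, Finset.HasAntidiagonal.mem_antidiagonal.mp hp]

lemma one (hJ : IsSepFiltration J) (T : A) : IsEval J 1 T 1 := fun M => by
  cases M with
  | zero => simpa using hJ.one_mem
  | succ M => simp [PowerSeries.coeff_one]

lemma X (hJ : IsSepFiltration J) (hT : T ∈ J 1) : IsEval J PowerSeries.X T T := fun M => by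
  match M with
  | 0 => simpa using hJ.mem_zero hT
  | 1 => simpa using hT
  | M + 2 => simp [PowerSeries.coeff_X]

lemma commute (hJ : IsSepFiltration J) {z : A} (hz : z ∈ J 0) (h : IsEval J F T s)
    (hzT : Commute z T) : Commute z s :=
  IsSeriesSum.semiconj hJ hz h h fun n => ((hzT.pow_right n).smul_right _).eq

end IsEval

end Filtration

/-! ### The `q`-exponential series -/

section QExponential

variable {q : ℂ}

/-- The power series `∑ (-X)ⁿ / (q;q)_n`. -/
def eqSeries (q : ℂ) : PowerSeries ℂ := PowerSeries.mk fun n => (-1 : ℂ) ^ n / qPoch q n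

/-- The power series `∑ q^{n(n-1)/2} Xⁿ / (q;q)_n`. -/
def EqSeries (q : ℂ) : PowerSeries ℂ :=
  PowerSeries.mk fun n => q ^ (n * (n - 1) / 2) / qPoch q n

lemma coeff_eqSeries (q : ℂ) (n : ℕ) :
    PowerSeries.coeff n (eqSeries q) = (-1) ^ n / qPoch q n :=
  PowerSeries.coeff_mk _ _

lemma coeff_EqSeries (q : ℂ) (n : ℕ) :
    PowerSeries.coeff n (EqSeries q) = q ^ (n * (n - 1) / 2) / qPoch q n :=
  PowerSeries.coeff_mk _ _

lemma one_sub_pow_ne_zero (hq : ∀ n : ℕ, 0 < n → q ^ n ≠ 1) (n : ℕ) : 1 - q ^ (n + 1) ≠ 0 :=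
  sub_ne_zero.mpr (hq (n + 1) n.succ_pos).symm

lemma qPoch_ne_zero (hq : ∀ n : ℕ, 0 < n → q ^ n ≠ 1) (n : ℕ) : qPoch q n ≠ 0 :=
  Finset.prod_ne_zero_iff.mpr fun k _ => one_sub_pow_ne_zero hq k

lemma qPoch_succ (q : ℂ) (n : ℕ) : qPoch q (n + 1) = qPoch q n * (1 - q ^ (n + 1)) :=
  Finset.prod_range_succ _ _

lemma coeff_zero_eqSeries (q : ℂ) : PowerSeries.coeff 0 (eqSeries q) = 1 := by
  simp [coeff_eqSeries, qPoch, -PowerSeries.coeff_zero_eq_constantCoeff]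

lemma coeff_zero_EqSeries (q : ℂ) : PowerSeries.coeff 0 (EqSeries q) = 1 := by
  simp [coeff_EqSeries, qPoch, -PowerSeries.coeff_zero_eq_constantCoeff]

lemma coeff_succ_eqSeries (hq : ∀ n : ℕ, 0 < n → q ^ n ≠ 1) (n : ℕ) :
    (1 - q ^ (n + 1)) * PowerSeries.coeff (n + 1) (eqSeries q)
      = -PowerSeries.coeff n (eqSeries q) := by
  have h1 := one_sub_pow_ne_zero hq n
  have h2 := qPoch_ne_zero hq n
  simp only [coeff_eqSeries, qPoch_succ]
  field_simp
  ring

lemma coeff_succ_EqSeries (hq : ∀ n : ℕ, 0 < n → q ^ n ≠ 1) (n : ℕ) :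
    (1 - q ^ (n + 1)) * PowerSeries.coeff (n + 1) (EqSeries q)
      = q ^ n * PowerSeries.coeff n (EqSeries q) := by
  have h1 := one_sub_pow_ne_zero hq n
  have h2 := qPoch_ne_zero hq n
  have h3 : (n + 1) * (n + 1 - 1) / 2 = n + n * (n - 1) / 2 := by
    rw [← Finset.sum_range_id, ← Finset.sum_range_id, Finset.sum_range_succ, add_comm]
  simp only [coeff_EqSeries, qPoch_succ, h3, pow_add q n (n * (n - 1) / 2)]
  field_simp

lemma rescale_eqSeries (hq : ∀ n : ℕ, 0 < n → q ^ n ≠ 1) :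
    PowerSeries.rescale q (eqSeries q) = (1 + PowerSeries.X) * eqSeries q := by
  ext n
  cases n with
  | zero => simp [add_mul]
  | succ n =>
    rw [PowerSeries.coeff_rescale, add_mul, one_mul, map_add, PowerSeries.coeff_succ_X_mul]
    linear_combination -coeff_succ_eqSeries hq n

lemma rescale_EqSeries (hq : ∀ n : ℕ, 0 < n → q ^ n ≠ 1) :
    (1 + PowerSeries.X) * PowerSeries.rescale q (EqSeries q) = EqSeries q := by
  ext n
  cases n with
  | zero =>
    rw [add_mul, one_mul, map_add, PowerSeries.coeff_zero_X_mul, PowerSeries.coeff_rescale]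
    simp
  | succ n =>
    rw [add_mul, one_mul, map_add, PowerSeries.coeff_succ_X_mul, PowerSeries.coeff_rescale,
      PowerSeries.coeff_rescale]
    linear_combination -coeff_succ_EqSeries hq n

lemma eqSeries_mul_EqSeries (hq : ∀ n : ℕ, 0 < n → q ^ n ≠ 1) :
    eqSeries q * EqSeries q = 1 := by
  have h : PowerSeries.rescale q (eqSeries q * EqSeries q) = eqSeries q * EqSeries q := by
    rw [map_mul, rescale_eqSeries hq, mul_comm _ (eqSeries q), mul_assoc, rescale_EqSeries hq]
  ext n
  cases n with
  | zero => simp [PowerSeries.coeff_mul, coeff_zero_eqSeries, coeff_zero_EqSeries]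
  | succ n =>
    have h1 := congrArg (PowerSeries.coeff (n + 1)) h
    rw [PowerSeries.coeff_rescale] at h1
    rw [PowerSeries.coeff_one, if_neg n.succ_ne_zero]
    have h2 : (1 - q ^ (n + 1)) * PowerSeries.coeff (n + 1) (eqSeries q * EqSeries q) = 0 := by
      linear_combination -h1
    exact (mul_eq_zero.mp h2).resolve_left (one_sub_pow_ne_zero hq n)

variable {A : Type*} [Ring A] [Algebra ℂ A]

lemma mul_pow_of_qcomm {a b : A} (hab : b * a = q • (a * b)) (n : ℕ) :
    b * a ^ n = q ^ n • (a ^ n * b) := by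
  induction n with
  | zero => simp
  | succ n ih =>
    rw [pow_succ, ← mul_assoc, ih, smul_mul_assoc, mul_assoc, hab, mul_smul_comm, smul_smul,
      ← mul_assoc, ← pow_succ]

lemma pow_mul_of_qcomm {a b : A} (hab : b * a = q • (a * b)) (n : ℕ) :
    b ^ n * a = q ^ n • (a * b ^ n) := by
  induction n with
  | zero => simp
  | succ n ih =>
    rw [pow_succ', mul_assoc, ih, mul_smul_comm, ← mul_assoc, hab, smul_mul_assoc, smul_smul,
      mul_assoc, ← pow_succ]

/-- The `q`-binomial theorem, divided by `(q;q)_n`. -/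
lemma eqSeries_smul_add_pow (hq : ∀ n : ℕ, 0 < n → q ^ n ≠ 1) {a b : A}
    (hab : b * a = q • (a * b)) (n : ℕ) :
    PowerSeries.coeff n (eqSeries q) • (a + b) ^ n = ∑ p ∈ Finset.HasAntidiagonal.antidiagonal n,
      (PowerSeries.coeff p.1 (eqSeries q) • a ^ p.1)
        * (PowerSeries.coeff p.2 (eqSeries q) • b ^ p.2) := by
  set c := fun n => PowerSeries.coeff n (eqSeries q) with hc
  have hcs : ∀ n, (1 - q ^ (n + 1)) * c (n + 1) = -c n := coeff_succ_eqSeries hq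
  change c n • (a + b) ^ n
    = ∑ p ∈ Finset.HasAntidiagonal.antidiagonal n, (c p.1 • a ^ p.1) * (c p.2 • b ^ p.2)
  simp only [smul_mul_smul_comm]
  induction n with
  | zero => simp [hc, coeff_zero_eqSeries]
  | succ n ih =>
    have hn := one_sub_pow_ne_zero hq n
    refine smul_right_injective A hn ?_
    simp only [smul_smul, hcs]
    rw [pow_succ', ← mul_smul_comm, neg_smul, ih, Finset.smul_sum]
    have h1 : ∀ p ∈ Finset.HasAntidiagonal.antidiagonal (n + 1),
        (1 - q ^ (n + 1)) • (c p.1 * c p.2) • (a ^ p.1 * b ^ p.2)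
          = (((1 - q ^ p.1) * c p.1) * c p.2) • (a ^ p.1 * b ^ p.2)
            + (q ^ p.1 * c p.1 * ((1 - q ^ p.2) * c p.2)) • (a ^ p.1 * b ^ p.2) := by
      intro p hp
      rw [← Finset.HasAntidiagonal.mem_antidiagonal.mp hp, smul_smul, ← add_smul, pow_add]
      congr 1
      ring
    rw [Finset.sum_congr rfl h1, Finset.sum_add_distrib, Finset.Nat.sum_antidiagonal_succ,
      Finset.Nat.sum_antidiagonal_succ' (f := fun p : ℕ × ℕ =>
        (q ^ p.1 * c p.1 * ((1 - q ^ p.2) * c p.2)) • (a ^ p.1 * b ^ p.2))]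
    simp only [hcs, pow_zero, sub_self, zero_mul, mul_zero, zero_smul, zero_add]
    rw [mul_neg, Finset.mul_sum, ← Finset.sum_neg_distrib, ← Finset.sum_add_distrib]
    refine Finset.sum_congr rfl fun p _ => ?_
    rw [mul_smul_comm, add_mul, ← mul_assoc b, mul_pow_of_qcomm hab, smul_mul_assoc, ← mul_assoc,
      ← pow_succ', mul_assoc (a ^ p.1), ← pow_succ']
    module

variable {J : ℕ → Submodule ℂ A}

lemma IsEval.eqSeries_add (hJ : IsSepFiltration J) (hq : ∀ n : ℕ, 0 < n → q ^ n ≠ 1) {a b s r : A}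
    (hab : b * a = q • (a * b)) (ha : IsEval J (eqSeries q) a s) (hb : IsEval J (eqSeries q) b r) :
    IsEval J (eqSeries q) (a + b) (s * r) := by
  unfold IsEval
  convert IsSeriesSum.mul hJ ha hb using 2 with n
  exact eqSeries_smul_add_pow hq hab n

/-- A `q`-exponential on the positive part of a filtered algebra: `e x = e_q(-x)` and
`E x = E_q(x)`. -/
structure IsQExp (q : ℂ) (J : ℕ → Submodule ℂ A) (e E : A → A) : Prop where
  filtration : IsSepFiltration J
  generic : ∀ n : ℕ, 0 < n → q ^ n ≠ 1
  eval : ∀ {x}, x ∈ J 1 → IsEval J (eqSeries q) x (e x)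
  eval_inv : ∀ {x}, x ∈ J 1 → IsEval J (EqSeries q) x (E x)

namespace IsQExp

variable {e E : A → A} {x y : A}

lemma mul_inv (h : IsQExp q J e E) (hx : x ∈ J 1) : e x * E x = 1 := by
  have h1 := (h.eval hx).mul h.filtration (h.eval_inv hx)
  rw [eqSeries_mul_EqSeries h.generic] at h1
  exact IsSeriesSum.unique h.filtration h1 (IsEval.one h.filtration x)

lemma inv_mul (h : IsQExp q J e E) (hx : x ∈ J 1) : E x * e x = 1 := by
  have h1 := (h.eval_inv hx).mul h.filtration (h.eval hx)
  rw [mul_comm, eqSeries_mul_EqSeries h.generic] at h1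
  exact IsSeriesSum.unique h.filtration h1 (IsEval.one h.filtration x)

lemma commute_right (h : IsQExp q J e E) (hx : x ∈ J 1) (hy : y ∈ J 0) (hxy : Commute y x) :
    Commute y (e x) :=
  (h.eval hx).commute h.filtration hy hxy

lemma commute (h : IsQExp q J e E) (hx : x ∈ J 1) (hy : y ∈ J 1) (hxy : Commute x y) :
    Commute (e x) (e y) :=
  h.commute_right hy (IsSeriesSum.mem_zero (h.eval hx))
    (h.commute_right hx (h.filtration.mem_zero hy) hxy.symm).symm

/-- The pentagon identity. -/
lemma pentagon (h : IsQExp q J e E) (hx : x ∈ J 1) (hy : y ∈ J 1)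
    (hyx : y * x = q • (x * y)) : e y * e x = e x * e (x * y) * e y := by
  have hJ := h.filtration
  have hxy : x * y ∈ J 1 := hJ.mul_mem_one hx hy
  have h1 : IsSeriesSum J (fun n => PowerSeries.coeff n (PowerSeries.rescale q (eqSeries q)) • y ^ n)
      ((1 + y) * e y) := by
    rw [rescale_eqSeries h.generic]
    exact ((IsEval.one hJ y).add (IsEval.X hJ hy)).mul hJ (h.eval hy)
  have h2 : SemiconjBy (e y) x (x + x * y) := by
    have h3 := h1.semiconj hJ (hJ.mem_zero hx) (h.eval hy) fun n => by
      rw [smul_mul_assoc, pow_mul_of_qcomm hyx, PowerSeries.coeff_rescale, mul_smul_comm, smul_smul,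
        mul_comm]
    rw [SemiconjBy, ← h3]
    noncomm_ring
  have h4 : IsEval J (eqSeries q) (x + x * y) (e x * e (x * y)) := by
    refine IsEval.eqSeries_add hJ h.generic ?_ (h.eval hx) (h.eval hxy)
    rw [mul_assoc, hyx, mul_smul_comm]
  exact IsSeriesSum.semiconj hJ (IsSeriesSum.mem_zero (h.eval hy)) (h.eval hx) h4 fun n => by
    rw [mul_smul_comm, (h2.pow_right n).eq, smul_mul_assoc]

end IsQExp

end QExponential

/-! ### Ordered products -/

section OrderedProduct

variable {M : Type*} [Monoid M]

/-- The product `F 0 * F 1 * ⋯ * F (n - 1)`. -/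
def ascProd (F : ℕ → M) : ℕ → M
  | 0 => 1
  | k + 1 => ascProd F k * F k

/-- The product `F (n - 1) * ⋯ * F 1 * F 0`. -/
def descProd (F : ℕ → M) : ℕ → M
  | 0 => 1
  | k + 1 => F k * descProd F k

lemma ascProd_congr {F G : ℕ → M} {n : ℕ} (h : ∀ j < n, F j = G j) :
    ascProd F n = ascProd G n := by
  induction n with
  | zero => rfl
  | succ n ih =>
    rw [ascProd, ascProd, ih fun j hj => h j (hj.trans n.lt_succ_self), h n n.lt_succ_self]

lemma ascProd_succ' (F : ℕ → M) (n : ℕ) :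
    ascProd F (n + 1) = F 0 * ascProd (fun j => F (j + 1)) n := by
  induction n with
  | zero => simp [ascProd]
  | succ n ih => rw [ascProd, ih, mul_assoc]; rfl

lemma descProd_succ' (F : ℕ → M) (n : ℕ) :
    descProd F (n + 1) = descProd (fun j => F (j + 1)) n * F 0 := by
  induction n with
  | zero => simp [descProd]
  | succ n ih => rw [descProd, ih, ← mul_assoc]; rfl

lemma ascProd_reflect (F : ℕ → M) (n : ℕ) :
    ascProd (fun j => F (n - 1 - j)) n = descProd F n := by
  induction n generalizing F with
  | zero => rfl
  | succ n ih =>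
    rw [descProd_succ', ← ih, ascProd, Nat.add_sub_cancel, Nat.sub_self]
    congr 1
    exact ascProd_congr fun j hj => congrArg F (by omega)

lemma commute_ascProd {z : M} {F : ℕ → M} {n : ℕ} (h : ∀ j < n, Commute z (F j)) :
    Commute z (ascProd F n) := by
  induction n with
  | zero => exact Commute.one_right z
  | succ n ih => exact (ih fun j hj => h j (hj.trans n.lt_succ_self)).mul_right (h n n.lt_succ_self)

lemma commute_descProd {z : M} {F : ℕ → M} {n : ℕ} (h : ∀ j < n, Commute z (F j)) :
    Commute z (descProd F n) := by
  rw [← ascProd_reflect]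
  exact commute_ascProd fun j hj => h _ (by omega)

lemma Units.val_ascProd (F : ℕ → Mˣ) (n : ℕ) :
    (ascProd F n : Mˣ) = ascProd (fun j => (F j : M)) n := by
  induction n with
  | zero => rfl
  | succ n ih => rw [ascProd, Units.val_mul, ih, ascProd]

lemma Units.val_inv_ascProd (F : ℕ → Mˣ) (n : ℕ) :
    (((ascProd F n)⁻¹ : Mˣ) : M) = descProd (fun j => (((F j)⁻¹ : Mˣ) : M)) n := by
  induction n with
  | zero => simp [ascProd, descProd]
  | succ n ih => rw [ascProd, mul_inv_rev, Units.val_mul, ih, descProd]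

end OrderedProduct

/-! ### Cyclic chains of `q`-commuting elements -/

section Chain

variable {q : ℂ} {A : Type*} [Ring A] [Algebra ℂ A] {J : ℕ → Submodule ℂ A} {e E : A → A}

lemma IsSepFiltration.descProd_mem (hJ : IsSepFiltration J) {X : ℕ → A} (hX : ∀ k, X k ∈ J 1)
    (n : ℕ) : descProd X (n + 1) ∈ J 1 := by
  induction n with
  | zero => simpa [descProd] using hX 0
  | succ n ih => exact hJ.mul_mem_one (hX (n + 1)) ih

lemma IsSepFiltration.ascProd_mem (hJ : IsSepFiltration J) {X : ℕ → A} (hX : ∀ k, X k ∈ J 1)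
    (n : ℕ) : ascProd X (n + 1) ∈ J 1 := by
  induction n with
  | zero => simpa [ascProd] using hX 0
  | succ n ih => exact hJ.mul_mem_one ih (hX (n + 1))

namespace IsQExp

/-- The unit `e x` with inverse `E x`. -/
def unit (h : IsQExp q J e E) {x : A} (hx : x ∈ J 1) : Aˣ :=
  ⟨e x, E x, h.mul_inv hx, h.inv_mul hx⟩

lemma mul_ascProd (h : IsQExp q J e E) {X : ℕ → A} (hX : ∀ k, X k ∈ J 1) {n : ℕ}
    (hadj : ∀ k < n, X k * X (k + 1) = q • (X (k + 1) * X k))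
    (hfar : ∀ k l, k + 1 < l → l ≤ n → Commute (X k) (X l)) :
    e (X 0) * ascProd (fun j => e (X (j + 1))) n
      = ascProd (fun j => e (X (j + 1))) n
        * descProd (fun j => e (descProd X (j + 1))) (n + 1) := by
  induction n with
  | zero => simp [ascProd, descProd]
  | succ n ih =>
    have hmem := h.filtration.descProd_mem hX
    have h1 : Commute (X (n + 1)) (descProd X n) :=
      commute_descProd fun j hj => (hfar j (n + 1) (by omega) le_rfl).symm
    have h2 : Commute (e (X (n + 1))) (descProd (fun j => e (descProd X (j + 1))) n) :=
      commute_descProd fun j hj => h.commute (hX _) (hmem j) <|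
        commute_descProd fun k hk => (hfar k (n + 1) (by omega) le_rfl).symm
    have h3 := h.pentagon (hX (n + 1)) (hmem n) (by
      rw [descProd, mul_assoc, ← h1.eq, ← mul_assoc, hadj n n.lt_succ_self, smul_mul_assoc,
        mul_assoc])
    rw [ascProd, ← mul_assoc, ih (fun k hk => hadj k (by omega)) fun k l hk hl =>
      hfar k l hk (by omega)]
    rw [mul_assoc, mul_assoc, descProd, mul_assoc, ← h2.eq, ← mul_assoc _ (e (X (n + 1))), h3]
    simp only [descProd, mul_assoc]

lemma descProd_mul (h : IsQExp q J e E) {Y : ℕ → A} (hY : ∀ k, Y k ∈ J 1) {n : ℕ}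
    (hadj : ∀ k < n, Y (k + 1) * Y k = q • (Y k * Y (k + 1)))
    (hfar : ∀ k l, k + 1 < l → l ≤ n → Commute (Y k) (Y l)) :
    descProd (fun j => e (Y (j + 1))) n * e (Y 0)
      = ascProd (fun j => e (ascProd Y (j + 1))) (n + 1)
        * descProd (fun j => e (Y (j + 1))) n := by
  induction n with
  | zero => simp [ascProd, descProd]
  | succ n ih =>
    have hmem := h.filtration.ascProd_mem hY
    have h1 : Commute (Y (n + 1)) (ascProd Y n) :=
      commute_ascProd fun j hj => (hfar j (n + 1) (by omega) le_rfl).symm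
    have h2 : Commute (e (Y (n + 1))) (ascProd (fun j => e (ascProd Y (j + 1))) n) :=
      commute_ascProd fun j hj => h.commute (hY _) (hmem j) <|
        commute_ascProd fun k hk => (hfar k (n + 1) (by omega) le_rfl).symm
    have h3 := h.pentagon (hmem n) (hY (n + 1)) (by
      rw [ascProd, ← mul_assoc, h1.eq, mul_assoc, hadj n n.lt_succ_self, mul_smul_comm, mul_assoc])
    rw [descProd, mul_assoc, ih (fun k hk => hadj k (by omega)) fun k l hk hl =>
      hfar k l hk (by omega)]
    rw [← mul_assoc, ascProd, ← mul_assoc, h2.eq, mul_assoc _ (e (Y (n + 1))), h3]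
    simp only [ascProd, mul_assoc]

end IsQExp

/-- If `a` `q`-commutes with `b` and `b`, `a` `q`-commute with `c` in opposite ways, then `c`
commutes with `b * a`. -/
lemma commute_mul_of_qcomm (hq0 : q ≠ 0) {a b c : A} (hac : c * a = q • (a * c))
    (hbc : b * c = q • (c * b)) : Commute c (b * a) := by
  refine smul_right_injective A hq0 ?_
  dsimp only
  rw [← mul_assoc, ← smul_mul_assoc, ← hbc, mul_assoc, hac, mul_smul_comm, mul_assoc]

/-- `X` is an `(n + 3)`-periodic sequence of elements of positive degree, in which cyclic
neighbours `q`-commute and all other entries commute. -/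
structure IsCyclicChain (q : ℂ) (J : ℕ → Submodule ℂ A) (n : ℕ) (X : ℕ → A) : Prop where
  mem : ∀ k, X k ∈ J 1
  adj : ∀ k, X k * X (k + 1) = q • (X (k + 1) * X k)
  far : ∀ k l, k + 1 < l → l ≤ k + n + 1 → Commute (X k) (X l)
  periodic : ∀ k, X (k + (n + 3)) = X k

/-- The operator `A` attached to the entries `X 0, …, X (n + 2)` of a chain. -/
def chainBlock (e E : A → A) (n : ℕ) (X : ℕ → A) : A :=
  ascProd (fun j => e (X (j + 1))) (n + 1)
    * (e (X (n + 2))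
      * (descProd (fun j => E (X (j + 1))) (n + 1)
        * (e (X 0) * ascProd (fun j => e (X (j + 1))) (n + 1))))

lemma group_block_eq {G : Type*} [Group G] {a b l m n p u w : G} (hp : p * l = u * w * p)
    (hau : Commute a u) (hbp : Commute b p) (hba : b * a = a * m * b) (hwb : w * b = b * n * w)
    (hwm : Commute w m) (han : Commute a n) :
    (a * p) * (l * ((a * p)⁻¹ * (b * (a * p)))) = (p * l) * (b * ((p * l)⁻¹ * (a * (p * l)))) := by
  have h1 : a * p * l = u * a * w * p := by
    rw [mul_assoc, hp, ← hau.eq]; simp only [mul_assoc]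
  have h2 : (a * p)⁻¹ * (b * (a * p)) = p⁻¹ * (m * b * p) := by
    rw [mul_inv_rev, ← mul_assoc b, hba]; group
  have h3 : (p * l) * b = u * b * n * w * p := by
    rw [hp, mul_assoc, ← hbp.eq, ← mul_assoc, mul_assoc u, hwb]; simp only [mul_assoc]
  have h4 : (p * l)⁻¹ * (a * (p * l)) = p⁻¹ * w⁻¹ * a * w * p := by
    rw [hp, mul_assoc u, ← mul_assoc a, hau.eq]; group
  have h5 : a * (w * (m * b)) = b * (n * (a * w)) := by
    rw [← mul_assoc w, hwm.eq, mul_assoc, hwb, ← mul_assoc n, ← han.eq]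
    rw [← mul_assoc b, ← mul_assoc b, hba]
    simp only [mul_assoc]
  rw [← mul_assoc, h1, h2, ← mul_assoc (p * l), h3, h4]
  simp only [mul_assoc, mul_inv_cancel_left]
  rw [← mul_assoc m, ← mul_assoc w, ← mul_assoc a, h5]
  simp only [mul_assoc]

namespace IsCyclicChain

variable {n : ℕ} {X : ℕ → A}

lemma shift (hX : IsCyclicChain q J n X) : IsCyclicChain q J n fun k => X (k + 1) where
  mem k := hX.mem _
  adj k := hX.adj _
  far k l h1 h2 := hX.far _ _ (by omega) (by omega)
  periodic k := by rw [← hX.periodic (k + 1), add_right_comm]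

lemma chainBlock_eq_val (hX : IsCyclicChain q J n X) (h : IsQExp q J e E) :
    chainBlock e E n X = (ascProd (fun j => h.unit (hX.mem (j + 1))) (n + 1)
      * (h.unit (hX.mem (n + 2)) * ((ascProd (fun j => h.unit (hX.mem (j + 1))) (n + 1))⁻¹
        * (h.unit (hX.mem 0) * ascProd (fun j => h.unit (hX.mem (j + 1))) (n + 1)))) : Aˣ) := by
  simp only [Units.val_mul, Units.val_ascProd, Units.val_inv_ascProd]
  rfl

lemma descProd_mul_ascProd (hX : IsCyclicChain q J n X) (h : IsQExp q J e E) (k : ℕ) :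
    descProd (fun j => E (X (j + 1))) k * ascProd (fun j => e (X (j + 1))) k = 1 := by
  have h1 := Units.inv_mul (ascProd (fun j => h.unit (hX.mem (j + 1))) k)
  rwa [Units.val_inv_ascProd, Units.val_ascProd] at h1

lemma ascProd_mul_descProd (hX : IsCyclicChain q J n X) (h : IsQExp q J e E) (k : ℕ) :
    ascProd (fun j => e (X (j + 1))) k * descProd (fun j => E (X (j + 1))) k = 1 := by
  have h1 := Units.mul_inv (ascProd (fun j => h.unit (hX.mem (j + 1))) k)
  rwa [Units.val_inv_ascProd, Units.val_ascProd] at h1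

lemma chainBlock_eq_desc (hX : IsCyclicChain q J n X) (h : IsQExp q J e E) :
    chainBlock e E n X = ascProd (fun j => e (X (j + 1))) (n + 2)
      * (ascProd (fun j => e (descProd X (n + 1 - j + 1))) (n + 1) * e (X 0)) := by
  have h1 := h.mul_ascProd hX.mem (n := n + 1) (fun k _ => hX.adj k)
    fun k l h1 h2 => hX.far k l h1 (by omega)
  have h2 : ascProd (fun j => e (descProd X (n + 1 - j + 1))) (n + 1) * e (X 0)
      = descProd (fun j => e (descProd X (j + 1))) (n + 2) := by
    rw [descProd_succ', ← ascProd_reflect]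
    congr 1
    · refine ascProd_congr fun j hj => ?_
      rw [show n + 1 - 1 - j + 1 = n + 1 - j by omega]
    · simp [descProd]
  rw [h2, chainBlock, h1, ← mul_assoc (descProd _ _), hX.descProd_mul_ascProd h, one_mul,
    ← mul_assoc]
  rfl

/-- Moving `e (X (k + m + 1))` to the left past `e (X (k + 1)) ⋯ e (X (k + m))`. -/
lemma ascProd_mul (hX : IsCyclicChain q J n X) (h : IsQExp q J e E) {k m : ℕ} (hm : m ≤ n + 1) :
    ascProd (fun j => e (X (k + 1 + j))) m * e (X (k + 1 + m))
      = ascProd (fun r => e (ascProd (fun j => X (k + 1 + m - j)) (r + 1))) (m + 1)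
        * ascProd (fun j => e (X (k + 1 + j))) m := by
  have hfar : ∀ a b, a + 1 < b → b ≤ m → Commute (X (k + 1 + m - a)) (X (k + 1 + m - b)) :=
    fun a b h1 h2 => (hX.far _ _ (by omega) (by omega)).symm
  have h1 := h.descProd_mul (Y := fun j => X (k + 1 + m - j)) (fun _ => hX.mem _)
    (fun a ha => by
      have := hX.adj (k + 1 + m - (a + 1))
      rwa [show k + 1 + m - (a + 1) + 1 = k + 1 + m - a by omega] at this) hfar
  have h2 : descProd (fun j => e (X (k + 1 + m - (j + 1)))) m
      = ascProd (fun j => e (X (k + 1 + j))) m := by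
    rw [← ascProd_reflect]
    refine ascProd_congr fun j hj => ?_
    rw [show k + 1 + m - (m - 1 - j + 1) = k + 1 + j by omega]
  rwa [h2] at h1

lemma chainBlock_eq_asc (hX : IsCyclicChain q J n X) (h : IsQExp q J e E) :
    chainBlock e E n X
      = ascProd (fun r => e (ascProd (fun j => X (n + 2 - j)) (r + 1))) (n + 2)
        * ascProd (fun j => e (X j)) (n + 2) := by
  have h1 := hX.ascProd_mul h (k := 0) (m := n + 1) le_rfl
  have h2 : ∀ j, 0 + 1 + j = j + 1 := fun j => by omega
  simp only [h2] at h1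
  rw [chainBlock, ← mul_assoc, h1, mul_assoc, ← mul_assoc _ (descProd _ _),
    hX.ascProd_mul_descProd h, one_mul,
    ascProd_succ' (fun j => e (X j)) (n + 1)]

lemma chainBlock_shift (hX : IsCyclicChain q J n X) (h : IsQExp q J e E) (hq0 : q ≠ 0) :
    chainBlock e E n (fun k => X (k + 1)) = chainBlock e E n X := by
  have hJ := h.filtration
  have hX0 : X (n + 3) = X 0 := by simpa using hX.periodic 0
  have hU : ∀ r, ascProd (fun j => X (n + 2 - j)) (r + 1) ∈ J 1 :=
    hJ.ascProd_mem fun _ => hX.mem _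
  set w := ascProd (fun j => X (n + 2 - j)) (n + 1) with hw
  have hwX0 : w * X 0 = q • (X 0 * w) := by
    have h1 : Commute (X 0) (ascProd (fun j => X (n + 2 - (j + 1))) n) :=
      commute_ascProd fun j hj => hX.far _ _ (by omega) (by omega)
    have h2 := hX.adj (n + 2)
    rw [hX0] at h2
    rw [hw, ascProd_succ', mul_assoc, ← h1.eq, ← mul_assoc, Nat.sub_zero, h2, smul_mul_assoc,
      mul_assoc]
  have hX1w : X 1 * w = q • (w * X 1) := by
    have h1 : Commute (X 1) (ascProd (fun j => X (n + 2 - j)) n) :=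
      commute_ascProd fun j hj => hX.far _ _ (by omega) (by omega)
    rw [hw, ascProd, ← mul_assoc, h1.eq, mul_assoc, show n + 2 - n = 1 + 1 by omega, hX.adj 1,
      mul_smul_comm, mul_assoc]
  have hw1 : w ∈ J 1 := hU n
  have hadj := hX.adj 0
  have hm := hJ.mul_mem_one (hX.mem 1) (hX.mem 0)
  have hn := hJ.mul_mem_one (hX.mem 0) hw1
  set φ : ∀ k, Aˣ := fun k => h.unit (hX.mem k) with hφ
  have key := group_block_eq (a := φ 1) (b := φ 0) (l := φ (n + 2)) (m := h.unit hm)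
    (n := h.unit hn) (p := ascProd (fun j => φ (j + 2)) n) (u := ascProd (fun r => h.unit (hU r)) n)
    (w := h.unit hw1) ?_ ?_ ?_ ?_ ?_ ?_ ?_
  · rw [hX.chainBlock_eq_val h, hX.shift.chainBlock_eq_val h]
    have h0 : h.unit (hX.shift.mem (n + 2)) = φ 0 := Units.ext (congrArg e hX0)
    have h1 : ascProd (fun j => h.unit (hX.mem (j + 1))) (n + 1)
        = φ 1 * ascProd (fun j => φ (j + 2)) n := ascProd_succ' _ _
    have h2 : ascProd (fun j => h.unit (hX.shift.mem (j + 1))) (n + 1)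
        = ascProd (fun j => φ (j + 2)) n * φ (n + 2) := rfl
    rw [h0, h1, h2]
    exact congrArg Units.val key.symm
  · refine Units.ext ?_
    have h1 := hX.ascProd_mul h (k := 1) (m := n) (by omega)
    simp only [Units.val_mul, Units.val_ascProd]
    have h2 : ∀ j, 1 + 1 + j = j + 2 := fun j => by omega
    simp only [h2] at h1
    exact h1
  · exact commute_ascProd fun r hr => Commute.units_of_val <| h.commute (hX.mem 1) (hU r) <|
      commute_ascProd fun j hj => hX.far _ _ (by omega) (by omega)
  · exact commute_ascProd fun j hj => Commute.units_of_val <| h.commute (hX.mem 0) (hX.mem _) <|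
      hX.far _ _ (by omega) (by omega)
  · exact Units.ext (h.pentagon (hX.mem 1) (hX.mem 0) hadj)
  · exact Units.ext (h.pentagon (hX.mem 0) hw1 hwX0)
  · exact Commute.units_of_val (h.commute hw1 hm (commute_mul_of_qcomm hq0 hwX0 hX1w))
  · exact Commute.units_of_val (h.commute (hX.mem 1) hn (commute_mul_of_qcomm hq0 hX1w hadj))

end IsCyclicChain

end Chain

/-! ### Degree-raising operators on power series -/

section PowerSeriesOperators

lemma degOf_add (μ ν : ZMod N →₀ ℕ) : degOf (μ + ν) = degOf μ + degOf ν :=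
  Finsupp.sum_add_index' (fun _ => rfl) fun _ _ _ => rfl

/-- Power series of order at least `d`. -/
def orderGE (N d : ℕ) : Submodule ℂ (MvPowerSeries (ZMod N) ℂ) where
  carrier := {f | ∀ ν, degOf ν < d → f ν = 0}
  zero_mem' _ _ := rfl
  add_mem' {f g} hf hg ν hν := by
    change f ν + g ν = 0
    rw [hf ν hν, hg ν hν, add_zero]
  smul_mem' c f hf ν hν := by
    change c * f ν = 0
    rw [hf ν hν, mul_zero]

lemma orderGE_anti : Antitone (orderGE N) := fun _ _ h _ hf ν hν => hf ν (hν.trans_le h)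

/-- Operators raising the order by at least `k`. -/
def raising (N k : ℕ) : Submodule ℂ (Module.End ℂ (MvPowerSeries (ZMod N) ℂ)) where
  carrier := {T | ∀ d, ∀ f ∈ orderGE N d, T f ∈ orderGE N (d + k)}
  zero_mem' _ _ _ := Submodule.zero_mem _
  add_mem' hS hT d f hf := Submodule.add_mem _ (hS d f hf) (hT d f hf)
  smul_mem' c _ hT d f hf := Submodule.smul_mem _ c (hT d f hf)

lemma isSepFiltration_raising : IsSepFiltration (raising N) where
  one_mem _ _ hf := hf
  mul_mem {m n _ _} hS hT d f hf := by
    rw [add_comm m, ← add_assoc]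
    exact hS _ _ (hT d f hf)
  anti _ _ h _ hT d f hf := orderGE_anti (Nat.add_le_add_left h d) (hT d f hf)
  eq_zero {T} hT := by
    ext1 f
    funext ν
    exact hT (degOf ν + 1) 0 f (fun μ hμ => absurd hμ (Nat.not_lt_zero _)) ν (by omega)

/-- The operator `∑ c n • T ^ n`, summed up to degree at each coefficient. -/
def seriesEnd (c : ℕ → ℂ) (T : Module.End ℂ (MvPowerSeries (ZMod N) ℂ)) :
    Module.End ℂ (MvPowerSeries (ZMod N) ℂ) where
  toFun f := fun ν => ∑ n ∈ Finset.range (degOf ν + 1), c n * (T ^ n) f ν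
  map_add' f g := by
    funext ν
    refine Eq.trans ?_ Finset.sum_add_distrib
    refine Finset.sum_congr rfl fun n _ => ?_
    rw [map_add, ← mul_add]
    rfl
  map_smul' a f := by
    funext ν
    refine Eq.trans ?_ (Finset.mul_sum _ _ a).symm
    refine Finset.sum_congr rfl fun n _ => ?_
    rw [map_smul, mul_left_comm]
    rfl

lemma isEval_seriesEnd (F : PowerSeries ℂ) {T : Module.End ℂ (MvPowerSeries (ZMod N) ℂ)}
    (hT : T ∈ raising N 1) :
    IsEval (raising N) F T (seriesEnd (fun n => PowerSeries.coeff n F) T) := by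
  intro M d f hf ν hν
  have hzero : ∀ n, degOf ν < d + n → PowerSeries.coeff n F * (T ^ n) f ν = 0 := fun n hn => by
    rw [isSepFiltration_raising.pow_mem hT n d f hf ν hn, mul_zero]
  have hsum : ∀ m K, (∀ n, m ≤ n → degOf ν < d + n) → m ≤ K →
      ∑ n ∈ Finset.range m, PowerSeries.coeff n F * (T ^ n) f ν
        = ∑ n ∈ Finset.range K, PowerSeries.coeff n F * (T ^ n) f ν := fun m K hm hK =>
    Finset.sum_subset (Finset.range_mono hK) fun n _ hn =>
      hzero n (hm n (not_lt.mp fun h => hn (Finset.mem_range.mpr h)))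
  have hright : (∑ n ∈ Finset.range M, PowerSeries.coeff n F • T ^ n) f ν
      = ∑ n ∈ Finset.range M, PowerSeries.coeff n F * (T ^ n) f ν := by
    rw [LinearMap.sum_apply]
    exact map_sum (MvPowerSeries.coeff (R := ℂ) ν)
      (fun n => PowerSeries.coeff n F • (T ^ n) f) (Finset.range M)
  change (∑ n ∈ Finset.range (degOf ν + 1), PowerSeries.coeff n F * (T ^ n) f ν)
    - (∑ n ∈ Finset.range M, PowerSeries.coeff n F • T ^ n) f ν = 0
  rw [hright, hsum (degOf ν + 1) (degOf ν + 1 + M) (fun n hn => by omega) (by omega),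
    hsum M (degOf ν + 1 + M) (fun n hn => by omega) (by omega), sub_self]

/-- `e_q(-T)` as a linear operator. -/
def eqEnd (q : ℂ) (T : Module.End ℂ (MvPowerSeries (ZMod N) ℂ)) :
    Module.End ℂ (MvPowerSeries (ZMod N) ℂ) :=
  seriesEnd (fun n => PowerSeries.coeff n (eqSeries q)) T

/-- `E_q(T)` as a linear operator. -/
def EqEnd (q : ℂ) (T : Module.End ℂ (MvPowerSeries (ZMod N) ℂ)) :
    Module.End ℂ (MvPowerSeries (ZMod N) ℂ) :=
  seriesEnd (fun n => PowerSeries.coeff n (EqSeries q)) T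

lemma eqExp_coe (q : ℂ) (T : Module.End ℂ (MvPowerSeries (ZMod N) ℂ)) :
    eqExp q T = eqEnd q T := by
  funext f ν
  refine Finset.sum_congr rfl fun n _ => ?_
  rw [← Module.End.pow_apply]
  exact congrArg (· * (T ^ n) f ν) (coeff_eqSeries q n).symm

lemma EqExp_coe (q : ℂ) (T : Module.End ℂ (MvPowerSeries (ZMod N) ℂ)) :
    EqExp q T = EqEnd q T := by
  funext f ν
  refine Finset.sum_congr rfl fun n _ => ?_
  rw [← Module.End.pow_apply]
  exact congrArg (· * (T ^ n) f ν) (coeff_EqSeries q n).symm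

lemma isQExp_eqEnd {q : ℂ} (hq : ∀ n : ℕ, 0 < n → q ^ n ≠ 1) :
    IsQExp q (raising N) (eqEnd q) (EqEnd q) where
  filtration := isSepFiltration_raising
  generic := hq
  eval := isEval_seriesEnd _
  eval_inv := isEval_seriesEnd _

variable {R V : Type*} [Semiring R] [AddCommMonoid V] [Module R V]

lemma compAsc_coe (F : ℕ → Module.End R V) (n : ℕ) :
    compAsc (fun j => ⇑(F j)) n = ascProd F n := by
  induction n with
  | zero => rfl
  | succ n ih => rw [compAsc, ih]; rfl

lemma compDesc_coe (F : ℕ → Module.End R V) (n : ℕ) :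
    compDesc (fun j => ⇑(F j)) n = descProd F n := by
  induction n with
  | zero => rfl
  | succ n ih => rw [compDesc, ih]; rfl

/-- The diagonal operator `x^ν ↦ χ ν • x^ν`. -/
def diagEnd (χ : (ZMod N →₀ ℕ) → ℂ) : Module.End ℂ (MvPowerSeries (ZMod N) ℂ) where
  toFun f := fun ν => χ ν * f ν
  map_add' _ _ := funext fun _ => mul_add _ _ _
  map_smul' _ _ := funext fun _ => mul_left_comm _ _ _

lemma diagEnd_comm (χ ψ : (ZMod N →₀ ℕ) → ℂ) (f : MvPowerSeries (ZMod N) ℂ) :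
    diagEnd χ (diagEnd ψ f) = diagEnd ψ (diagEnd χ f) :=
  funext fun _ => mul_left_comm _ _ _

lemma diagEnd_X_mul {χ : (ZMod N →₀ ℕ) → ℂ} (hχ : ∀ μ ν, χ (μ + ν) = χ μ * χ ν) (j : ZMod N)
    (f : MvPowerSeries (ZMod N) ℂ) :
    diagEnd χ (MvPowerSeries.X j * f)
      = χ (Finsupp.single j 1) • (MvPowerSeries.X j * diagEnd χ f) := by
  ext ν
  change χ ν * MvPowerSeries.coeff ν (MvPowerSeries.X j * f) = _
  rw [MvPowerSeries.coeff_smul, MvPowerSeries.coeff_mul, MvPowerSeries.coeff_mul, Finset.mul_sum,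
    Finset.mul_sum]
  refine Finset.sum_congr rfl fun p hp => ?_
  rw [← Finset.HasAntidiagonal.mem_antidiagonal.mp hp, MvPowerSeries.coeff_X]
  change _ = _ * (_ * (χ p.2 * MvPowerSeries.coeff p.2 f))
  split_ifs with h
  · rw [h, hχ]; ring
  · ring

/-- The character by which `p_i ∘ p_{i-1}⁻¹` acts on monomials. -/
def xhatChar (q : ℂ) (i : ZMod N) (ν : ZMod N →₀ ℕ) : ℂ := q ^ ((ν i : ℤ) - ν (i - 1))

lemma xhatChar_add {q : ℂ} (hq0 : q ≠ 0) (i : ZMod N) (μ ν : ZMod N →₀ ℕ) :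
    xhatChar q i (μ + ν) = xhatChar q i μ * xhatChar q i ν := by
  rw [xhatChar, xhatChar, xhatChar, ← zpow_add₀ hq0]
  congr 1
  simp only [Finsupp.add_apply]
  push_cast
  ring

/-- `x̂_i` as a linear operator. -/
def xhatEnd (q : ℂ) (α : ZMod N → ℂ) (i : ZMod N) : Module.End ℂ (MvPowerSeries (ZMod N) ℂ) :=
  α i • (LinearMap.mulLeft ℂ (MvPowerSeries.X i) ∘ₗ diagEnd (xhatChar q i))

lemma xhat_eq_coe {q : ℂ} (hq0 : q ≠ 0) (α : ZMod N → ℂ) (i : ZMod N) :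
    xhat q α i = xhatEnd q α i := by
  funext f
  have h : pmap q i (pinv q (i - 1) f) = diagEnd (xhatChar q i) f := by
    funext ν
    change q ^ ν i * (q ^ (-(ν (i - 1) : ℤ)) * f ν) = q ^ ((ν i : ℤ) - ν (i - 1)) * f ν
    rw [sub_eq_add_neg (ν i : ℤ), zpow_add₀ hq0, zpow_natCast, mul_assoc]
  rw [xhat, h]
  rfl

lemma xhatEnd_mem_raising (q : ℂ) (α : ZMod N → ℂ) (i : ZMod N) :
    xhatEnd q α i ∈ raising N 1 := by
  refine Submodule.smul_mem _ _ fun d f hf ν hν => ?_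
  change MvPowerSeries.coeff ν (MvPowerSeries.X i * diagEnd (xhatChar q i) f) = 0
  rw [MvPowerSeries.coeff_mul]
  refine Finset.sum_eq_zero fun p hp => ?_
  rw [MvPowerSeries.coeff_X]
  split_ifs with h
  · rw [← Finset.HasAntidiagonal.mem_antidiagonal.mp hp, h, degOf_add] at hν
    have h1 : degOf (Finsupp.single i 1) = 1 := Finsupp.sum_single_index rfl
    change 1 * (xhatChar q i p.2 * f p.2) = 0
    rw [hf p.2 (by omega), mul_zero, mul_zero]
  · exact zero_mul _

lemma xhatEnd_mul {q : ℂ} (hq0 : q ≠ 0) (α : ZMod N → ℂ) (i j : ZMod N) :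
    xhatChar q j (Finsupp.single i 1) • (xhatEnd q α i * xhatEnd q α j)
      = xhatChar q i (Finsupp.single j 1) • (xhatEnd q α j * xhatEnd q α i) := by
  have key : ∀ i j f, (xhatEnd q α i * xhatEnd q α j) f = xhatChar q i (Finsupp.single j 1) •
      (α i * α j) • (MvPowerSeries.X i * (MvPowerSeries.X j *
        diagEnd (xhatChar q i) (diagEnd (xhatChar q j) f))) := fun i j f => by
    change α i • (MvPowerSeries.X i * diagEnd (xhatChar q i)
      (α j • (MvPowerSeries.X j * diagEnd (xhatChar q j) f))) = _
    rw [map_smul, diagEnd_X_mul (xhatChar_add hq0 i)]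
    simp only [mul_smul_comm, smul_smul]
    congr 1
    ring
  ext1 f
  rw [LinearMap.smul_apply, LinearMap.smul_apply, key, key, diagEnd_comm, mul_comm (α j),
    mul_left_comm (MvPowerSeries.X j), smul_comm]

lemma xhatChar_single (q : ℂ) (i j : ZMod N) :
    xhatChar q i (Finsupp.single j 1)
      = q ^ ((if j = i then 1 else 0) - (if j = i - 1 then 1 else 0) : ℤ) := by
  rw [xhatChar, Finsupp.single_apply, Finsupp.single_apply]
  push_cast
  rfl

lemma zmod_natCast_ne_zero {m : ℕ} (h0 : 0 < m) (hm : m < N) : (m : ZMod N) ≠ 0 := fun h =>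
  absurd (Nat.le_of_dvd h0 ((ZMod.natCast_eq_zero_iff m N).mp h)) (not_le.mpr hm)

lemma isCyclicChain_xhatEnd {q : ℂ} (hq0 : q ≠ 0) {n : ℕ} (α : ZMod (n + 3) → ℂ)
    (i : ZMod (n + 3)) :
    IsCyclicChain q (raising (n + 3)) n fun k => xhatEnd q α (i + (k : ZMod (n + 3))) where
  mem k := xhatEnd_mem_raising q α _
  adj k := by
    have h1 : (1 : ZMod (n + 3)) ≠ 0 := by
      simpa using zmod_natCast_ne_zero (N := n + 3) one_pos (by omega)
    have h2 : (2 : ZMod (n + 3)) ≠ 0 := by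
      simpa using zmod_natCast_ne_zero (N := n + 3) two_pos (by omega)
    have h := xhatEnd_mul hq0 α (i + (k : ZMod (n + 3))) (i + ((k + 1 : ℕ) : ZMod (n + 3)))
    rw [xhatChar_single, xhatChar_single, if_neg, if_pos, if_neg, if_neg] at h
    · simp only [sub_zero, zero_sub, zpow_zero, one_smul, zpow_neg_one] at h
      rw [← h, smul_smul, mul_inv_cancel₀ hq0, one_smul]
    · exact fun h' => h2 (by push_cast at h'; linear_combination h')
    · exact fun h' => h1 (by push_cast at h'; linear_combination h')
    · push_cast; ring
    · exact fun h' => h1 (by push_cast at h'; linear_combination -h')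
  far k l hkl hl := by
    obtain ⟨d, rfl⟩ := Nat.exists_eq_add_of_lt hkl
    have h1 := zmod_natCast_ne_zero (N := n + 3) (m := d + 1) (by omega) (by omega)
    have h2 := zmod_natCast_ne_zero (N := n + 3) (m := d + 2) (by omega) (by omega)
    have h3 := zmod_natCast_ne_zero (N := n + 3) (m := d + 3) (by omega) (by omega)
    push_cast at h1 h2 h3
    have h := xhatEnd_mul hq0 α (i + (k : ZMod (n + 3)))
      (i + ((k + 1 + d + 1 : ℕ) : ZMod (n + 3)))
    rw [xhatChar_single, xhatChar_single, if_neg, if_neg, if_neg, if_neg] at h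
    · simpa [commute_iff_eq] using h
    · exact fun h' => h3 (by push_cast at h'; linear_combination h')
    · exact fun h' => h2 (by push_cast at h'; linear_combination h')
    · exact fun h' => h1 (by push_cast at h'; linear_combination -h')
    · exact fun h' => h2 (by push_cast at h'; linear_combination -h')
  periodic k := by
    rw [Nat.cast_add, ZMod.natCast_self, add_zero]

lemma Ablock_eq_chainBlock {q : ℂ} (hq0 : q ≠ 0) (n : ℕ) (α : ZMod (n + 3) → ℂ)
    (i : ZMod (n + 3)) :
    Ablock q (n + 3) α i
      = chainBlock (eqEnd q) (EqEnd q) n fun k => xhatEnd q α (i + (k : ZMod (n + 3))) := by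
  simp only [Ablock, xhat_eq_coe hq0, eqExp_coe, EqExp_coe, compAsc_coe, compDesc_coe, chainBlock,
    Nat.cast_zero, add_zero]
  rfl

lemma Ablock_eq_Bblock {q : ℂ} (hq0 : q ≠ 0) (hq : ∀ n : ℕ, 0 < n → q ^ n ≠ 1) (n : ℕ)
    (α : ZMod (n + 3) → ℂ) (i : ZMod (n + 3)) :
    Ablock q (n + 3) α i = Bblock q (n + 3) α i := by
  rw [Ablock_eq_chainBlock hq0,
    (isCyclicChain_xhatEnd hq0 α i).chainBlock_eq_desc (isQExp_eqEnd hq)]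
  simp only [Bblock, xhat_eq_coe hq0, eqExp_coe, compAsc_coe, compDesc_coe, Nat.cast_zero, add_zero]
  rfl

lemma Ablock_add_one {q : ℂ} (hq0 : q ≠ 0) (hq : ∀ n : ℕ, 0 < n → q ^ n ≠ 1) (n : ℕ)
    (α : ZMod (n + 3) → ℂ) (i : ZMod (n + 3)) :
    Ablock q (n + 3) α (i + 1) = Ablock q (n + 3) α i := by
  rw [Ablock_eq_chainBlock hq0, Ablock_eq_chainBlock hq0,
    ← (isCyclicChain_xhatEnd hq0 α i).chainBlock_shift (isQExp_eqEnd hq) hq0]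
  congr 2
  funext k
  congr 1
  push_cast
  ring

lemma Ablock_add_one_eq_Btblock {q : ℂ} (hq0 : q ≠ 0) (hq : ∀ n : ℕ, 0 < n → q ^ n ≠ 1) (n : ℕ)
    (α : ZMod (n + 3) → ℂ) (i : ZMod (n + 3)) :
    Ablock q (n + 3) α (i + 1) = Btblock q (n + 3) α i := by
  rw [Ablock_eq_chainBlock hq0,
    (isCyclicChain_xhatEnd hq0 α (i + 1)).chainBlock_eq_asc (isQExp_eqEnd hq)]
  simp only [Btblock, xhat_eq_coe hq0, eqExp_coe, compAsc_coe]
  have h1 : ascProd (fun r => eqEnd q (ascProd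
        (fun j => xhatEnd q α (i + 1 + ((n + 2 - j : ℕ) : ZMod (n + 3)))) (r + 1))) (n + 2)
      = ascProd (fun r => eqEnd q (ascProd (fun j => xhatEnd q α (i - (j : ZMod (n + 3)))) (r + 1)))
        (n + 2) := by
    refine ascProd_congr fun r hr => congrArg _ (ascProd_congr fun j hj => congrArg _ ?_)
    have h := ZMod.natCast_self (n + 3)
    rw [Nat.cast_sub (by omega)]
    push_cast at h ⊢
    linear_combination h
  have h2 : ∀ j : ℕ, i + 1 + (j : ZMod (n + 3)) = i + ((j + 1 : ℕ) : ZMod (n + 3)) := fun j => by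
    push_cast
    ring
  rw [h1]
  simp only [h2]
  rfl

end PowerSeriesOperators

/-- **Proposition 2.8**: `A_i = B_i = B̃_i` for every `i`, and the common
operator is independent of `i` (Dynkin-automorphism invariance). -/
theorem dynkin_invariance (q : ℂ) (hq0 : q ≠ 0) (hq : ∀ n : ℕ, 0 < n → q ^ n ≠ 1)
    (N : ℕ) [NeZero N] (hN : 3 ≤ N) (α : ZMod N → ℂ) :
    (∀ i : ZMod N, Ablock q N α i = Bblock q N α i)
    ∧ (∀ i : ZMod N, Ablock q N α i = Btblock q N α i)
    ∧ (∀ i j : ZMod N, Ablock q N α i = Ablock q N α j) := by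
  obtain ⟨n, rfl⟩ := Nat.exists_eq_add_of_le' hN
  have hconst : ∀ i, Ablock q (n + 3) α i = Ablock q (n + 3) α 0 := fun i => by
    rw [← ZMod.natCast_zmod_val i]
    induction i.val with
    | zero => rw [Nat.cast_zero]
    | succ k ih => rw [Nat.cast_succ, Ablock_add_one hq0 hq, ih]
  refine ⟨Ablock_eq_Bblock hq0 hq n α, fun i => ?_, fun i j => (hconst i).trans (hconst j).symm⟩
  rw [← Ablock_add_one hq0 hq, Ablock_add_one_eq_Btblock hq0 hq]
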